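/- For every integer n ≥ 1, p_{n;=n} = n^{n−1}; and for all integers k ≥ 1 and n ≥ k+1, p_{n;=n−k} = p_{n;=n−k+1} + C(n,k+1) · (n−k)^{n−k−2} − Σ_{i=1}^{k} C(n,i) · p_{n−i;=n−k}. -/

import Mathlib

/-- A parking function of length `n`: a sequence of positive integers whose
nondecreasing rearrangement `b` satisfies `b i ≤ i` (1-indexed). -/
def IsParkingFunction (n : ℕ) (a : Fin n → ℕ) : Prop :=
  (∀ i, 1 ≤ a i) ∧
  ∃ σ : Equiv.Perm (Fin n), Monotone (a ∘ σ) ∧ ∀ i : Fin n, a (σ i) ≤ (i : ℕ) + 1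

/-- A parking function of length `n` with `m ≥ n` parking spaces: entries in `[1,m]`
whose nondecreasing rearrangement `b` satisfies `b i ≤ m - n + i` (1-indexed). -/
def IsParkingFunctionWith (n m : ℕ) (a : Fin n → ℕ) : Prop :=
  (∀ i, 1 ≤ a i ∧ a i ≤ m) ∧
  ∃ σ : Equiv.Perm (Fin n), Monotone (a ∘ σ) ∧ ∀ i : Fin n, a (σ i) ≤ m - n + ((i : ℕ) + 1)

/-- `pN n` = number of parking functions of length `n` (so `pN n = (n+1)^(n-1)`). -/
noncomputable def pN (n : ℕ) : ℕ := Nat.card {a : Fin n → ℕ // IsParkingFunction n a}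

/-- `pWith n m` = `p_{n,m;≤m}`, the number of parking functions of length `n`
with `m` parking spaces. -/
noncomputable def pWith (n m : ℕ) : ℕ := Nat.card {a : Fin n → ℕ // IsParkingFunctionWith n m a}

/-- `pLe n s` = `p_{n;≤s}`, the number of parking functions of length `n`
all of whose entries are at most `s`. -/
noncomputable def pLe (n s : ℕ) : ℕ :=
  Nat.card {a : Fin n → ℕ // IsParkingFunction n a ∧ ∀ i, a i ≤ s}

/-- `pEq n s` = `p_{n;=s} = p_{n;≤s} - p_{n;≤s-1}` (with `p_{n;≤s} = 0` for `s < 0`). -/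
noncomputable def pEq (n s : ℕ) : ℕ := pLe n s - (if s = 0 then 0 else pLe n (s - 1))

/-- `pLeL n s l` = `p_{n;≤s}^l`, the number of parking functions of length `n` with all
entries at most `s` and first entry equal to `l`. -/
noncomputable def pLeL (n s l : ℕ) : ℕ :=
  Nat.card {a : Fin n → ℕ //
    IsParkingFunction n a ∧ (∀ i, a i ≤ s) ∧ (List.ofFn a).head? = some l}

/-- `pL n l` = `p_n^l`, the number of parking functions of length `n` with first entry `l`. -/
noncomputable def pL (n l : ℕ) : ℕ :=
  Nat.card {a : Fin n → ℕ //
    IsParkingFunction n a ∧ (List.ofFn a).head? = some l}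

/-- `pEqL n s l` = `p_{n;=s}^l = p_{n;≤s}^l - p_{n;≤s-1}^l`. -/
noncomputable def pEqL (n s l : ℕ) : ℕ := pLeL n s l - (if s = 0 then 0 else pLeL n (s - 1) l)

/-- Simulate the parking process with `m` spaces: cars arrive in order with the given
preference list, each parks in the first free space among `pref, pref+1, …, m` if any;
returns the number of cars that leave unparked, given the set `occ` of occupied spaces. -/
def flawCount (m : ℕ) : List ℕ → Finset ℕ → ℕ
  | [], _ => 0
  | p :: rest, occ =>
    match (List.range' p (m + 1 - p)).find? (fun s => decide (s ∉ occ)) with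
    | some s => flawCount m rest (insert s occ)
    | none => flawCount m rest occ + 1

/-- `pFlaw n m k` = `p_{n,m;≤m;k}`, the number of `k`-flaw preference sets of length `n`
with `m` parking spaces and all entries in `[1,m]`. -/
noncomputable def pFlaw (n m k : ℕ) : ℕ :=
  Nat.card {a : Fin n → ℕ //
    (∀ i, 1 ≤ a i ∧ a i ≤ m) ∧ flawCount m (List.ofFn a) ∅ = k}

/-- `P(x) = Σ_{n≥0} (n+1)^(n-1) xⁿ/n!` in `ℚ[[x]]`. -/
noncomputable def Pser : PowerSeries ℚ :=
  PowerSeries.mk fun n => ((n : ℚ) + 1) ^ (n - 1) / n.factorial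

/-- `Q_k(x) = Σ_{n≥0} p_{n,n+k;≤n+k} xⁿ/n!` in `ℚ[[x]]`. -/
noncomputable def Qser (k : ℕ) : PowerSeries ℚ :=
  PowerSeries.mk fun n => (pWith n (n + k) : ℚ) / n.factorial

/-- `R_k(x) = Σ_{n≥k} p_{n;≤n-k} xⁿ/n!` in `ℚ[[x]]`. -/
noncomputable def Rser (k : ℕ) : PowerSeries ℚ :=
  PowerSeries.mk fun n => if n < k then 0 else (pLe n (n - k) : ℚ) / n.factorial

/-- `H_k(x) = Σ_{n≥k} p_{n;=n-k} xⁿ/n!` in `ℚ[[x]]`. -/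
noncomputable def Hser (k : ℕ) : PowerSeries ℚ :=
  PowerSeries.mk fun n => if n < k then 0 else (pEq n (n - k) : ℚ) / n.factorial

/-- `T_k(x) = Σ_{n≥k+1} p_n^{n-k} xⁿ/(n-1)!` in `ℚ[[x]]`. -/
noncomputable def Tser (k : ℕ) : PowerSeries ℚ :=
  PowerSeries.mk fun n => if n < k + 1 then 0 else (pL n (n - k) : ℚ) / (n - 1).factorial

/-- `F_{k,s}(x) = Σ_{n≥s+1} p_{n;≤n-k}^{n-s} xⁿ/(n-1)!` in `ℚ[[x]]`. -/
noncomputable def Fser (k s : ℕ) : PowerSeries ℚ :=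
  PowerSeries.mk fun n =>
    if n < s + 1 then 0 else (pLeL n (n - k) (n - s) : ℚ) / (n - 1).factorial

open Finset

/-- Lattice-path style predicate for bounded parking functions on an arbitrary index type. -/
def GoodSeq (ι : Type) [Fintype ι] (s : ℕ) (a : ι → ℕ) : Prop :=
  (∀ i, 1 ≤ a i ∧ a i ≤ s) ∧ ∀ j ≤ s, j ≤ (univ.filter fun i => a i ≤ j).card

noncomputable def goodCount (ι : Type) [Fintype ι] (s : ℕ) : ℕ :=
  Nat.card {a : ι → ℕ // GoodSeq ι s a}

noncomputable def NN (n s : ℕ) : ℕ := goodCount (Fin n) s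

instance goodFinite (ι : Type) [Fintype ι] (s : ℕ) : Finite {a : ι → ℕ // GoodSeq ι s a} := by
  apply Finite.of_injective
    (fun a : {a : ι → ℕ // GoodSeq ι s a} => fun i => (⟨a.1 i, Nat.lt_succ_of_le (a.2.1 i).2⟩ : Fin (s+1)))
  intro a b h
  apply Subtype.ext
  funext i
  have := congrFun h i
  simpa using this

lemma goodSeq_comp {ι κ : Type} [Fintype ι] [Fintype κ] (e : ι ≃ κ) (s : ℕ) (a : κ → ℕ) :
    GoodSeq ι s (a ∘ e) ↔ GoodSeq κ s a := by
  have hc : ∀ j, (univ.filter fun i => (a ∘ e) i ≤ j).card = (univ.filter fun i => a i ≤ j).card := by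
    intro j
    refine Finset.card_bij (fun i _ => e i) ?_ ?_ ?_
    · intro i hi; simpa using hi
    · intro i _ i' _ h; exact e.injective h
    · intro b hb
      exact ⟨e.symm b, by simpa using hb, by simp⟩
  unfold GoodSeq
  simp only [hc]
  refine and_congr ?_ Iff.rfl
  constructor
  · intro h i; simpa using h (e.symm i)
  · intro h i; exact h (e i)

lemma goodCount_congr {ι κ : Type} [Fintype ι] [Fintype κ] (e : ι ≃ κ) (s : ℕ) :
    goodCount ι s = goodCount κ s := by
  unfold goodCount
  refine Nat.card_congr (Equiv.symm ?_)
  refine (Equiv.arrowCongr e.symm (Equiv.refl ℕ)).subtypeEquiv ?_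
  intro a
  exact (goodSeq_comp e s a).symm

lemma goodCount_eq_NN (ι : Type) [Fintype ι] (s : ℕ) : goodCount ι s = NN (Fintype.card ι) s :=
  goodCount_congr (Fintype.equivFin ι) s

lemma NN_lt {n s : ℕ} (h : n < s) : NN n s = 0 := by
  unfold NN goodCount
  have : IsEmpty {a : Fin n → ℕ // GoodSeq (Fin n) s a} := by
    refine ⟨fun a => ?_⟩
    have h1 := a.2.2 s le_rfl
    have h2 := Finset.card_le_univ (univ.filter fun i => a.1 i ≤ s)
    simp only [Fintype.card_fin] at h2
    omega
  exact Nat.card_of_isEmpty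

lemma NN_zero (n : ℕ) : NN n 0 = 0 ^ n := by
  rcases Nat.eq_zero_or_pos n with rfl | h
  · unfold NN goodCount
    have : Unique {a : Fin 0 → ℕ // GoodSeq (Fin 0) 0 a} :=
      { default := ⟨Fin.elim0, fun i => i.elim0, by simp⟩
        uniq := fun a => Subtype.ext (Subsingleton.elim _ _) }
    simp
  · rw [zero_pow (by omega)]
    unfold NN goodCount
    have : IsEmpty {a : Fin n → ℕ // GoodSeq (Fin n) 0 a} := by
      refine ⟨fun a => ?_⟩
      have := a.2.1 ⟨0, h⟩
      omega
    exact Nat.card_of_isEmpty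

def fiberEquiv (n s : ℕ) (hs : s + 1 ≤ n) (S : Finset (Fin n)) :
    {x : {a : Fin n → ℕ // GoodSeq (Fin n) (s+1) a} // (univ.filter fun i => x.1 i ≤ s) = S} ≃
      {b : S → ℕ // GoodSeq S s b} where
  toFun x := ⟨fun i => x.1.1 i.1, by
    obtain ⟨⟨a, ha⟩, hx⟩ := x
    subst hx
    refine ⟨fun i => ⟨(ha.1 i.1).1, (Finset.mem_filter.1 i.2).2⟩, fun j hj => ?_⟩
    refine (ha.2 j (by omega)).trans (le_of_eq ?_)
    refine (Finset.card_bij (fun i _ => i.1) ?_ ?_ ?_).symm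
    · intro i hi; simpa using hi
    · intro i _ i' _ h; exact Subtype.ext h
    · intro b hb
      simp only [mem_filter, mem_univ, true_and] at hb
      exact ⟨⟨b, by simpa using hb.trans hj⟩, by simpa using hb, rfl⟩⟩
  invFun b := ⟨⟨fun i => if h : i ∈ S then b.1 ⟨i, h⟩ else s + 1, by
      refine ⟨fun i => ?_, fun j hj => ?_⟩
      · by_cases h : i ∈ S
        · have := b.2.1 ⟨i, h⟩
          simp only [h, dif_pos]; omega
        · simp only [h, dif_neg, not_false_iff]; omega
      · rcases Nat.lt_or_ge s j with hj' | hj'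
        · have : (univ.filter fun i => (if h : i ∈ S then b.1 ⟨i, h⟩ else s + 1) ≤ j) = univ := by
            apply Finset.filter_true_of_mem
            intro i _
            by_cases h : i ∈ S
            · have := b.2.1 ⟨i, h⟩
              simp only [h, dif_pos]; omega
            · simp only [h, dif_neg, not_false_iff]; omega
          rw [this]; simp; omega
        · refine (b.2.2 j hj').trans ?_
          refine Finset.card_le_card_of_injOn (fun i => i.1) ?_ ?_
          · intro i hi
            simpa using hi
          · intro i _ i' _ h; exact Subtype.ext h⟩, by
      ext i
      by_cases h : i ∈ S
      · have := b.2.1 ⟨i, h⟩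
        simp [h]; omega
      · simp [h]⟩
  left_inv x := by
    obtain ⟨⟨a, ha⟩, hx⟩ := x
    subst hx
    apply Subtype.ext
    apply Subtype.ext
    funext i
    by_cases h : a i ≤ s
    · simp [h]
    · have := ha.1 i
      simp [h]; omega
  right_inv b := by
    apply Subtype.ext
    funext i
    simp

lemma NN_succ {n s : ℕ} (hs : s + 1 ≤ n) :
    NN n (s+1) = ∑ m ∈ range (n+1), n.choose m * NN m s := by
  have h1 : NN n (s+1) = ∑ S : Finset (Fin n), goodCount S s := by
    unfold NN
    unfold goodCount
    rw [← Nat.card_congr (Equiv.sigmaFiberEquiv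
      (fun x : {a : Fin n → ℕ // GoodSeq (Fin n) (s+1) a} => (univ.filter fun i => x.1 i ≤ s)))]
    rw [Nat.card_sigma]
    exact Finset.sum_congr rfl fun S _ => Nat.card_congr (fiberEquiv n s hs S)
  rw [h1, ← Finset.powerset_univ]
  simp only [goodCount_eq_NN, Fintype.card_coe]
  rw [Finset.sum_powerset_apply_card (fun m => NN m s)]
  simp

lemma park_iff (n s : ℕ) (hs : s ≤ n) (a : Fin n → ℕ) :
    (IsParkingFunction n a ∧ ∀ i, a i ≤ s) ↔ GoodSeq (Fin n) s a := by
  constructor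
  · rintro ⟨⟨h1, σ, _, h3⟩, h4⟩
    refine ⟨fun i => ⟨h1 i, h4 i⟩, fun j hj => ?_⟩
    have : (univ : Finset (Fin j)).card ≤ (univ.filter fun i => a i ≤ j).card := by
      refine Finset.card_le_card_of_injOn (fun i => σ (Fin.castLE (hj.trans hs) i)) ?_ ?_
      · intro i _
        have := h3 (Fin.castLE (hj.trans hs) i)
        simp only [Fin.val_castLE] at this
        simp only [coe_filter, mem_univ, true_and, Set.mem_setOf_eq]
        omega
      · intro i _ i' _ h
        exact Fin.castLE_injective _ (σ.injective h)
    simpa using this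
  · rintro ⟨h1, h2⟩
    refine ⟨⟨fun i => (h1 i).1, Tuple.sort a, Tuple.monotone_sort a, fun i => ?_⟩, fun i => (h1 i).2⟩
    by_contra! hlt
    have hb := (h1 (Tuple.sort a i)).2
    have h3 := h2 (i+1) (by omega)
    have h4 : (univ.filter fun x => a x ≤ (i:ℕ)+1).card ≤ (univ.filter fun x : Fin n => x < i).card := by
      refine Finset.card_le_card_of_injOn (fun x => (Tuple.sort a).symm x) ?_ ?_
      · intro x hx
        simp only [coe_filter, mem_univ, true_and, Set.mem_setOf_eq] at hx ⊢
        by_contra! hge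
        have := Tuple.monotone_sort a hge
        simp only [Function.comp, Equiv.apply_symm_apply] at this
        omega
      · intro x _ y _ h
        exact (Tuple.sort a).symm.injective h
    have h5 : (univ.filter fun x : Fin n => x < i).card = i := by
      rw [show (univ.filter fun x : Fin n => x < i) = Finset.Iio i by ext; simp, Fin.card_Iio]
    omega

lemma pLe_eq {n s : ℕ} (hs : s ≤ n) : pLe n s = NN n s := by
  unfold pLe NN goodCount
  exact Nat.card_congr (Equiv.subtypeEquivRight fun a => park_iff n s hs a)

lemma pEq_eq {n s : ℕ} (hs : s + 1 ≤ n) :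
    pEq n (s+1) = ∑ m ∈ range n, n.choose m * NN m s := by
  unfold pEq
  rw [pLe_eq hs, if_neg (by omega), Nat.add_sub_cancel, pLe_eq (by omega), NN_succ hs,
    sum_range_succ]
  simp

lemma pEq_eq' {n s : ℕ} (hs : s + 1 ≤ n) :
    (pEq n (s+1) : ℤ) = NN n (s+1) - NN n s := by
  rw [NN_succ hs, sum_range_succ, ← pEq_eq hs]
  simp

open Polynomial in
lemma poly_ext_of_derivative (p q : ℚ[X]) (x : ℚ) (h : derivative p = derivative q)
    (h0 : p.eval x = q.eval x) : p = q := by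
  have h1 : derivative (p - q) = 0 := by simp [h]
  have h2 := Polynomial.natDegree_eq_zero_of_derivative_eq_zero h1
  obtain ⟨c, hc⟩ := Polynomial.natDegree_eq_zero.1 h2
  have h3 : (p - q).eval x = 0 := by simp [h0]
  rw [← hc] at h3
  simp only [eval_C] at h3
  rw [h3, C_0] at hc
  exact (sub_eq_zero.1 hc.symm)

lemma alt_sum (n : ℕ) :
    ∑ m ∈ range (n + 2), (-1 : ℚ) ^ (n + 1 - m) * ((n+1).choose m : ℚ) * ((m : ℚ) + 1) ^ n = 0 := by
  have h := fwdDiff_iter_eq_sum_shift (1 : ℚ) (fun r : ℚ => r ^ n) (n+1) 1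
  rw [fwdDiff_iter_pow_eq_zero_of_lt (Nat.lt_succ_self n)] at h
  simp only [Pi.zero_apply] at h
  rw [h]
  refine Finset.sum_congr rfl fun m _ => ?_
  simp only [zsmul_eq_mul, nsmul_eq_mul, mul_one]
  push_cast
  ring

open Polynomial in
lemma abel_poly (n : ℕ) :
    ∑ m ∈ range (n + 1), (C ((n.choose m : ℚ) * ((m : ℚ) + 1) ^ (m - 1)) * (X - C (m : ℚ)) ^ (n - m))
      = (X + 1 : ℚ[X]) ^ n := by
  induction n with
  | zero => simp
  | succ n ih =>
    apply poly_ext_of_derivative _ _ (-1)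
    · rw [derivative_sum, sum_range_succ]
      have e1 : derivative ((X + 1 : ℚ[X]) ^ (n+1)) = C ((n : ℚ) + 1) * (X + 1) ^ n := by
        simp [derivative_pow]
      rw [e1, ← ih, Finset.mul_sum]
      have e2 : derivative (C (((n+1).choose (n+1) : ℚ) * (((n+1 : ℕ) : ℚ) + 1) ^ (n + 1 - 1)) *
          (X - C ((n+1 : ℕ) : ℚ)) ^ (n + 1 - (n+1))) = 0 := by
        rw [Nat.sub_self, pow_zero, mul_one, derivative_C]
      rw [e2, add_zero]
      refine Finset.sum_congr rfl fun m hm => ?_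
      have hm : m ≤ n := by have := mem_range.1 hm; omega
      have hc : ((n+1).choose m : ℚ) * ((n - m : ℕ) + 1 : ℚ) = ((n : ℚ) + 1) * (n.choose m : ℚ) := by
        have := Nat.choose_mul_succ_eq n m
        have h2 : n + 1 - m = (n - m) + 1 := by omega
        rw [h2] at this
        have h3 : ((n.choose m * (n+1) : ℕ) : ℚ) = (((n+1).choose m * (n - m + 1) : ℕ) : ℚ) := by
          rw [this]
        push_cast [-Nat.cast_sub] at h3
        linarith
      rw [derivative_C_mul, derivative_X_sub_C_pow, ← mul_assoc, ← mul_assoc]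
      have h2 : n + 1 - m = (n - m) + 1 := by omega
      rw [h2, Nat.add_sub_cancel]
      congr 1
      have h4 : ((n - m + 1 : ℕ) : ℚ) = ((n - m : ℕ) : ℚ) + 1 := by
        push_cast [-Nat.cast_sub]; rfl
      rw [h4, ← C_mul, ← C_mul]
      congr 1
      linear_combination ((m : ℚ) + 1) ^ (m - 1) * hc
    · rw [eval_finset_sum]
      simp only [eval_mul, eval_C, eval_pow, eval_sub, eval_X, eval_add, eval_one]
      rw [neg_add_cancel, zero_pow (by omega), ← alt_sum n]
      refine Finset.sum_congr rfl fun m hm => ?_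
      have hm : m ≤ n + 1 := by have := mem_range.1 hm; omega
      have h1 : (-1 - (m : ℚ)) = (-1) * ((m : ℚ) + 1) := by ring
      have h2 : ((m : ℚ) + 1) ^ (m - 1) * ((m : ℚ) + 1) ^ (n + 1 - m) = ((m : ℚ) + 1) ^ n := by
        rcases Nat.eq_zero_or_pos m with rfl | h
        · simp
        · rw [← pow_add]; congr 1; omega
      rw [h1, mul_pow, ← h2]
      ring

lemma abel_int (n : ℕ) (y : ℤ) :
    ∑ m ∈ range (n + 1), (n.choose m : ℤ) * ((m : ℤ) + 1) ^ (m - 1) * (y - m) ^ (n - m)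
      = (y + 1) ^ n := by
  have h := congrArg (Polynomial.eval (y : ℚ)) (abel_poly n)
  rw [Polynomial.eval_finset_sum] at h
  simp only [Polynomial.eval_mul, Polynomial.eval_C, Polynomial.eval_pow, Polynomial.eval_sub,
    Polynomial.eval_X, Polynomial.eval_add, Polynomial.eval_one] at h
  exact_mod_cast h

/-- Binomial convolution of a shifted power. -/
lemma binom_shift (n m : ℕ) (x : ℤ) :
    ∑ l ∈ range (n + 1), (n.choose l : ℤ) * ((l.choose m : ℤ) * x ^ (l - m))
      = (n.choose m : ℤ) * (x + 1) ^ (n - m) := by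
  rcases Nat.lt_or_ge n m with h | h
  · rw [Nat.choose_eq_zero_of_lt h]
    simp only [Nat.cast_zero, zero_mul]
    refine Finset.sum_eq_zero fun l hl => ?_
    have := mem_range.1 hl
    rw [Nat.choose_eq_zero_of_lt (show l < m by omega)]
    simp
  · obtain ⟨d, rfl⟩ := Nat.exists_eq_add_of_le h
    rw [show m + d + 1 = m + (d + 1) by omega, sum_range_add]
    rw [Finset.sum_eq_zero, zero_add]
    · rw [Nat.add_sub_cancel_left, add_pow, Finset.mul_sum]
      refine Finset.sum_congr rfl fun i hi => ?_
      have hi : i ≤ d := by have := mem_range.1 hi; omega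
      have hc := Nat.choose_mul (n := m + d) (k := m + i) (s := m) (by omega)
      rw [Nat.add_sub_cancel_left, Nat.add_sub_cancel_left] at hc
      rw [Nat.add_sub_cancel_left]
      have hc' : ((m + d).choose (m + i) : ℤ) * ((m + i).choose m : ℤ)
          = ((m + d).choose m : ℤ) * (d.choose i : ℤ) := by exact_mod_cast hc
      rw [one_pow]
      linear_combination x ^ i * hc'
    · intro l hl
      have := mem_range.1 hl
      rw [Nat.choose_eq_zero_of_lt this]
      simp

lemma NN_formula (s : ℕ) : ∀ n : ℕ, (NN n s : ℤ) = (s : ℤ) ^ n -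
    ∑ m ∈ range s, (n.choose m : ℤ) * ((m : ℤ) + 1) ^ (m - 1) * ((s : ℤ) - 1 - m) ^ (n - m) := by
  induction s with
  | zero => intro n; simp [NN_zero]
  | succ s ih =>
    intro n
    rcases Nat.lt_or_ge n (s+1) with h | h
    · rw [NN_lt h]
      have ha := abel_int n s
      have : ∑ m ∈ range (s+1), (n.choose m : ℤ) * ((m : ℤ) + 1) ^ (m - 1) *
          (((s+1 : ℕ) : ℤ) - 1 - m) ^ (n - m) = ((s : ℤ) + 1) ^ n := by
        rw [← ha]
        symm
        push_cast
        simp only [add_sub_cancel_right]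
        refine Finset.sum_subset ?_ ?_
        · intro x hx
          simp only [mem_range] at *
          omega
        · intro x _ hx
          simp only [mem_range] at *
          rw [Nat.choose_eq_zero_of_lt (by omega)]
          simp
      rw [this]
      push_cast
      ring
    · rw [NN_succ h, sum_range_succ _ s]
      push_cast
      simp only [ih, mul_sub, Finset.sum_sub_distrib]
      have e1 : ∑ l ∈ range (n+1), (n.choose l : ℤ) * (s : ℤ) ^ l = ((s : ℤ) + 1) ^ n := by
        rw [add_pow]
        refine Finset.sum_congr rfl fun i _ => ?_
        simp [mul_comm]
      have e2 : ((s : ℤ) + 1 - 1 - s) ^ (n - s) = 0 := by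
        rw [show ((s : ℤ) + 1 - 1 - s) = 0 by ring, zero_pow (by omega)]
      rw [e1, e2, mul_zero, add_zero]
      congr 1
      simp only [Finset.mul_sum]
      rw [Finset.sum_comm]
      refine Finset.sum_congr rfl fun m _ => ?_
      have hb := binom_shift n m ((s : ℤ) - 1 - m)
      rw [show (s : ℤ) - 1 - m + 1 = (s : ℤ) + 1 - 1 - m by ring] at hb
      rw [mul_right_comm, ← hb, Finset.sum_mul]
      refine Finset.sum_congr rfl fun l _ => ?_
      ring

lemma NN_diag (n : ℕ) : NN n n = (n + 1) ^ (n - 1) := by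
  have h := NN_formula n n
  have ha := abel_int n ((n : ℤ) - 1)
  rw [sum_range_succ, sub_add_cancel] at ha
  rw [← ha] at h
  have : (NN n n : ℤ) = ((n : ℤ) + 1) ^ (n - 1) := by
    rw [h]; simp
  exact_mod_cast this

/-- `p_{n;=n} = n^{n-1}`, and for `k ≥ 1`, `n ≥ k+1`:
`p_{n;=n-k} = p_{n;=n-k+1} + C(n,k+1)(n-k)^{n-k-2} - Σ_{i=1}^k C(n,i) p_{n-i;=n-k}`. -/
theorem stmt7 :
    (∀ n : ℕ, 1 ≤ n → pEq n n = n ^ (n - 1)) ∧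
    (∀ k n : ℕ, 1 ≤ k → k + 1 ≤ n →
      (pEq n (n - k) : ℤ) =
        (pEq n (n - k + 1) : ℤ) +
          (n.choose (k + 1) : ℤ) * ((n : ℤ) - k) ^ (n - k - 2) -
          ∑ i ∈ Finset.Icc 1 k, (n.choose i : ℤ) * (pEq (n - i) (n - k) : ℤ)) := by
  constructor
  · intro n hn
    obtain ⟨s, rfl⟩ := Nat.exists_eq_add_of_le' hn
    rw [pEq_eq le_rfl, sum_range_succ, Finset.sum_eq_zero, zero_add, NN_diag,
      Nat.choose_succ_self_right, Nat.add_sub_cancel]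
    · rcases s with _ | s
      · simp
      · rw [Nat.add_sub_cancel, ← pow_succ']
    · intro m hm
      rw [NN_lt (mem_range.1 hm), mul_zero]
  · intro k n hk hkn
    obtain ⟨s, rfl⟩ := Nat.exists_eq_add_of_le' hkn
    have e1 : s + (k + 1) - k = s + 1 := by omega
    rw [e1]
    have hsum : ∑ i ∈ Finset.Icc 1 k, ((s + (k + 1)).choose i : ℤ) *
          (pEq (s + (k + 1) - i) (s + 1) : ℤ)
        = ∑ m ∈ Finset.Ico (s+1) (s+(k+1)), ((s + (k + 1)).choose m : ℤ) *
          ((NN m (s+1) : ℤ) - NN m s) := by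
      refine Finset.sum_bij' (fun i _ => s + (k+1) - i) (fun i _ => s + (k+1) - i) ?_ ?_ ?_ ?_ ?_
      · intro i hi
        simp only [mem_Icc, mem_Ico] at *
        omega
      · intro i hi
        simp only [mem_Icc, mem_Ico] at *
        omega
      · intro i hi
        simp only [mem_Icc] at *
        omega
      · intro i hi
        simp only [mem_Ico] at *
        omega
      · intro i hi
        simp only [mem_Icc] at *
        rw [pEq_eq' (by omega), Nat.choose_symm (by omega)]
    have hdrop : ∀ t ≤ s + (k+1), ∑ m ∈ range (s+(k+1)), ((s + (k + 1)).choose m * NN m t)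
        = ∑ m ∈ Finset.Ico t (s+(k+1)), ((s + (k + 1)).choose m * NN m t) := by
      intro t ht
      rw [Finset.range_eq_Ico, ← Finset.sum_Ico_consecutive _ (Nat.zero_le t) ht,
        Finset.sum_eq_zero, zero_add]
      intro m hm
      rw [NN_lt (mem_Ico.1 hm).2, mul_zero]
    rw [hsum, pEq_eq (by omega), pEq_eq (by omega), hdrop s (by omega), hdrop (s+1) (by omega),
      Finset.sum_eq_sum_Ico_succ_bot (by omega), NN_diag]
    simp only [mul_sub, Finset.sum_sub_distrib]
    have hch : (s + (k+1)).choose (k+1) = (s + (k+1)).choose s := by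
      rw [Nat.choose_symm_add]
    rw [hch, show s + 1 - 2 = s - 1 by omega]
    push_cast
    ring
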